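/- H has only finitely many edges containing the point μ if and only if every connected component of Π* ∩ J₀ is of finite type. -/

import Mathlib

open Set Module

noncomputable section

/-- The linear reflection `x ↦ x - f x • a` associated to a vector `a` and a linear
functional `f` with `f a = 2`, bundled as a linear automorphism. -/
def reflEquiv {V : Type*} [AddCommGroup V] [Module ℝ V]
    (a : V) (f : V →ₗ[ℝ] ℝ) (h2 : f a = 2) : V ≃ₗ[ℝ] V :=
  LinearEquiv.ofInvolutive (LinearMap.id - f.smulRight a)
    (fun x => by
      simp only [LinearMap.sub_apply, LinearMap.id_apply, LinearMap.smulRight_apply,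
        map_sub, map_smul, smul_eq_mul, h2]
      module)

/-- A realization over `ℝ` of an `m × m` generalized Cartan matrix `A`:
simple roots `α_i`, simple coroots `α_i∨` (as linear functionals), with
`⟨α_j, α_i∨⟩ = a_{ij}`, together with the defining axioms. -/
structure GCMRealization (m : ℕ) (V : Type*) [NormedAddCommGroup V] [NormedSpace ℝ V] where
  A : Matrix (Fin m) (Fin m) ℤ
  root : Fin m → V
  coroot : Fin m → V →ₗ[ℝ] ℝ
  one_le_m : 1 ≤ m
  A_diag : ∀ i, A i i = 2
  A_offdiag : ∀ i j, i ≠ j → A i j ≤ 0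
  A_zero_iff : ∀ i j, A i j = 0 ↔ A j i = 0
  root_indep : LinearIndependent ℝ root
  coroot_indep : LinearIndependent ℝ coroot
  pairing : ∀ i j, coroot i (root j) = (A i j : ℝ)
  finDim : FiniteDimensional ℝ V
  dim_eq : finrank ℝ V + (A.map ((↑) : ℤ → ℝ)).rank = 2 * m

/-- A face of a convex set `H`: a convex subset `F ⊆ H` such that whenever the open
segment between two points of `H` meets `F`, both points lie in `F`. -/
def IsFaceOf {V : Type*} [NormedAddCommGroup V] [NormedSpace ℝ V] (H F : Set V) : Prop :=
  Convex ℝ F ∧ IsExtreme ℝ H F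

namespace GCMRealization

variable {m : ℕ} {V : Type*} [NormedAddCommGroup V] [NormedSpace ℝ V]
variable (S : GCMRealization m V)

/-- The fundamental reflection `r_i`. -/
def s (i : Fin m) : V ≃ₗ[ℝ] V :=
  reflEquiv (S.root i) (S.coroot i) (by
    have h := S.pairing i i
    rw [S.A_diag i] at h
    simpa using h)

/-- The Weyl group `W`, as a subgroup of the group of linear automorphisms of `V`. -/
def W : Subgroup (V ≃ₗ[ℝ] V) := Subgroup.closure (Set.range S.s)

/-- The standard parabolic subgroup `W_I` generated by the reflections indexed by `I`. -/
def WI (I : Set (Fin m)) : Subgroup (V ≃ₗ[ℝ] V) := Subgroup.closure (S.s '' I)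

/-- The closed fundamental chamber `C̄`. -/
def chamber : Set V := {η | ∀ i, 0 ≤ S.coroot i η}

/-- `J₀`: the set of indices `i` with `⟨μ, α_i∨⟩ = 0`. -/
def J0 (μ : V) : Set (Fin m) := {i | S.coroot i μ = 0}

/-- The orbit of `μ` under a subgroup of linear automorphisms. -/
def orbitOf (G : Subgroup (V ≃ₗ[ℝ] V)) (μ : V) : Set V :=
  (fun w : V ≃ₗ[ℝ] V => w μ) '' (G : Set (V ≃ₗ[ℝ] V))

/-- `F_I`: the convex hull of `W_I · μ`. -/
def face (μ : V) (I : Set (Fin m)) : Set V := convexHull ℝ (orbitOf (S.WI I) μ)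

/-- `H`: the convex hull of the Weyl group orbit of `μ`. -/
def orbitHull (μ : V) : Set V := convexHull ℝ (orbitOf S.W μ)

/-- `ℝ₊I`: the set of nonnegative linear combinations of the simple roots indexed by `I`. -/
def coneNonneg (I : Set (Fin m)) : Set V :=
  {v | ∃ c : Fin m → ℝ, (∀ i, 0 ≤ c i) ∧ (∀ i, i ∉ I → c i = 0) ∧ v = ∑ i, c i • S.root i}

/-- `ℝ_>I`: the set of strictly positive linear combinations of the simple roots indexed
by `I` (with `ℝ_>∅ = {0}`). -/
def conePos (I : Set (Fin m)) : Set V :=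
  {v | ∃ c : Fin m → ℝ, (∀ i ∈ I, 0 < c i) ∧ (∀ i, i ∉ I → c i = 0) ∧ v = ∑ i, c i • S.root i}

/-- The open standard facet `C_J`. -/
def openFacet (J : Set (Fin m)) : Set V :=
  {η | (∀ i ∈ J, S.coroot i η = 0) ∧ ∀ i, i ∉ J → 0 < S.coroot i η}

/-- The closed standard facet `C̄_J`. -/
def closedFacet (J : Set (Fin m)) : Set V :=
  {η | (∀ i ∈ J, S.coroot i η = 0) ∧ ∀ i, i ∉ J → 0 ≤ S.coroot i η}

/-- Adjacency of two vertices of the Dynkin diagram: `i ≠ j` and `a_{ij} ≠ 0`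
(equivalently `a_{ji} ≠ 0`). -/
def Adjacent (i j : Fin m) : Prop := i ≠ j ∧ S.A i j ≠ 0 ∧ S.A j i ≠ 0

/-- The Dynkin diagram, as a simple graph on the index set. -/
def diagram : SimpleGraph (Fin m) where
  Adj := S.Adjacent
  symm := ⟨fun _ _ h => ⟨h.1.symm, h.2.2, h.2.1⟩⟩
  loopless := ⟨fun _ h => h.1 rfl⟩

/-- A subset `I` is `μ`-connected if every connected component of `I` meets
`J_> = Π \ J₀` (the empty set is `μ`-connected). -/
def MuConnected (μ : V) (I : Set (Fin m)) : Prop :=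
  ∀ i : I, ∃ j : I, S.coroot (j : Fin m) μ ≠ 0 ∧ (S.diagram.induce I).Reachable i j

/-- The connected component of `i` inside `K`, as a subset of the index set. -/
def comp (K : Set (Fin m)) (i : Fin m) : Set (Fin m) :=
  {j | ∃ (hi : i ∈ K) (hj : j ∈ K), (S.diagram.induce K).Reachable ⟨i, hi⟩ ⟨j, hj⟩}

/-- `I*`: the largest `μ`-connected subset of `I`, i.e. the union of the connected
components of `I` that meet `J_>`. -/
def muPart (μ : V) (I : Set (Fin m)) : Set (Fin m) :=
  {j | ∃ (hj : j ∈ I) (k : Fin m) (hk : k ∈ I), S.coroot k μ ≠ 0 ∧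
    (S.diagram.induce I).Reachable ⟨j, hj⟩ ⟨k, hk⟩}

/-- `I_*`: the set of `α ∈ J₀ \ I` orthogonal to all of `I`. -/
def starSet (μ : V) (I : Set (Fin m)) : Set (Fin m) :=
  {i | S.coroot i μ = 0 ∧ i ∉ I ∧ ∀ j ∈ I, S.coroot i (S.root j) = 0}

/-- A subset `K ⊆ Π` is of finite type if the subgroup `W_K` is finite. -/
def FiniteType (K : Set (Fin m)) : Prop := ((S.WI K : Subgroup (V ≃ₗ[ℝ] V)) : Set (V ≃ₗ[ℝ] V)).Finite

/-- Every connected component of `K` is of finite type. -/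
def FinTypeComponents (K : Set (Fin m)) : Prop := ∀ i ∈ K, S.FiniteType (S.comp K i)

/-- A fundamental face of `H`: a face which is empty or whose relative interior meets
the fundamental chamber. -/
def IsFundFace (μ : V) (F : Set V) : Prop :=
  IsFaceOf (S.orbitHull μ) F ∧ (F = ∅ ∨ (intrinsicInterior ℝ F ∩ S.chamber).Nonempty)

/-- The length of `w ∈ W` with respect to the fundamental reflections. -/
def len (w : V ≃ₗ[ℝ] V) : ℕ :=
  sInf {k | ∃ l : List (Fin m), l.length = k ∧ w = (l.map S.s).prod}

end GCMRealization

end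

namespace GCMRealization

variable {m : ℕ} {V : Type*} [NormedAddCommGroup V] [NormedSpace ℝ V]
variable (S : GCMRealization m V)

/-! ### Basic facts -/

lemma s_apply (i : Fin m) (v : V) : S.s i v = v - S.coroot i v • S.root i := by
  simp only [s, reflEquiv]
  rfl

lemma coroot_self (i : Fin m) : S.coroot i (S.root i) = 2 := by
  rw [S.pairing, S.A_diag]; norm_num

lemma s_sq (i : Fin m) : S.s i * S.s i = 1 := by
  ext v
  simp only [LinearEquiv.mul_apply, s_apply, LinearEquiv.coe_one, id, map_sub, map_smul,
    coroot_self, smul_eq_mul]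
  module

lemma s_inv (i : Fin m) : (S.s i)⁻¹ = S.s i := inv_eq_of_mul_eq_one_left (S.s_sq i)

lemma s_mem (i : Fin m) : S.s i ∈ S.W := Subgroup.subset_closure ⟨i, rfl⟩

lemma WI_le (I : Set (Fin m)) : S.WI I ≤ S.W :=
  Subgroup.closure_mono (Set.image_subset_range _ _)

lemma WI_mono {I J : Set (Fin m)} (h : I ⊆ J) : S.WI I ≤ S.WI J :=
  Subgroup.closure_mono (Set.image_mono h)

lemma prod_mem_W (l : List (Fin m)) : (l.map S.s).prod ∈ S.W := by
  apply Subgroup.list_prod_mem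
  intro x hx
  obtain ⟨i, -, rfl⟩ := List.mem_map.1 hx
  exact S.s_mem i

lemma exists_word {w : V ≃ₗ[ℝ] V} (hw : w ∈ S.W) :
    ∃ l : List (Fin m), w = (l.map S.s).prod := by
  induction hw using Subgroup.closure_induction with
  | mem x hx => obtain ⟨i, rfl⟩ := hx; exact ⟨[i], by simp⟩
  | one => exact ⟨[], by simp⟩
  | mul x y _ _ hx hy =>
    obtain ⟨l, rfl⟩ := hx; obtain ⟨l', rfl⟩ := hy
    exact ⟨l ++ l', by simp⟩
  | inv x _ hx =>
    obtain ⟨l, rfl⟩ := hx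
    refine ⟨l.reverse, ?_⟩
    rw [List.prod_inv_reverse, List.map_map, ← List.map_reverse]
    congr 1

lemma len_prod_le (l : List (Fin m)) : S.len (l.map S.s).prod ≤ l.length :=
  Nat.sInf_le ⟨l, rfl, rfl⟩

lemma exists_reduced {w : V ≃ₗ[ℝ] V} (hw : w ∈ S.W) :
    ∃ l : List (Fin m), l.length = S.len w ∧ w = (l.map S.s).prod := by
  obtain ⟨l, hl⟩ := S.exists_word hw
  exact Nat.sInf_mem (s := {k | ∃ l : List (Fin m), l.length = k ∧ w = (l.map S.s).prod})
    ⟨l.length, l, rfl, hl⟩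

lemma len_mul_le {u v : V ≃ₗ[ℝ] V} (hu : u ∈ S.W) (hv : v ∈ S.W) :
    S.len (u * v) ≤ S.len u + S.len v := by
  obtain ⟨l, hl, e⟩ := S.exists_reduced hu
  obtain ⟨l', hl', e'⟩ := S.exists_reduced hv
  have := S.len_prod_le (l ++ l')
  rw [List.map_append, List.prod_append, ← e, ← e', List.length_append, hl, hl'] at this
  exact this

lemma len_s_le (i : Fin m) : S.len (S.s i) ≤ 1 := by
  simpa using S.len_prod_le [i]

lemma len_one : S.len 1 = 0 := by
  simpa using S.len_prod_le []

/-- Last letter of a reduced word. -/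
lemma exists_last {w : V ≃ₗ[ℝ] V} (hw : w ∈ S.W) (h1 : w ≠ 1) :
    ∃ t : Fin m, ∃ w' ∈ S.W, w = w' * S.s t ∧ S.len w' + 1 = S.len w := by
  obtain ⟨l, hl, e⟩ := S.exists_reduced hw
  rcases List.eq_nil_or_concat l with rfl | ⟨l', t, rfl⟩
  · exact absurd (by simpa using e) h1
  · have e2 : w = (l'.map S.s).prod * S.s t := by simpa using e
    refine ⟨t, _, S.prod_mem_W l', e2, ?_⟩
    have h3 := S.len_prod_le l'
    have h4 := S.len_mul_le (S.prod_mem_W l') (S.s_mem t)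
    have h5 := S.len_s_le t
    rw [← e2] at h4
    simp at hl
    omega

/-! ### The cone of nonnegative combinations -/

/-- The cone spanned by the simple roots. -/
def cone : Set V := {v | ∃ c : Fin m → ℝ, (∀ i, 0 ≤ c i) ∧ v = ∑ i, c i • S.root i}

lemma root_mem_cone (i : Fin m) : S.root i ∈ S.cone := by
  classical
  refine ⟨Pi.single i 1, fun j => ?_, ?_⟩
  · by_cases h : j = i
    · subst h; simp
    · simp [h]
  · simp [Pi.single_apply, ite_smul]

lemma zero_mem_cone : (0 : V) ∈ S.cone := ⟨0, by simp, by simp⟩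

lemma add_mem_cone {x y : V} (hx : x ∈ S.cone) (hy : y ∈ S.cone) : x + y ∈ S.cone := by
  obtain ⟨c, hc, rfl⟩ := hx
  obtain ⟨d, hd, rfl⟩ := hy
  exact ⟨c + d, fun i => add_nonneg (hc i) (hd i), by simp [add_smul, Finset.sum_add_distrib]⟩

lemma smul_mem_cone {x : V} {a : ℝ} (ha : 0 ≤ a) (hx : x ∈ S.cone) : a • x ∈ S.cone := by
  obtain ⟨c, hc, rfl⟩ := hx
  exact ⟨a • c, fun i => mul_nonneg ha (hc i), by simp [mul_smul, Finset.smul_sum]⟩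

/-- Coordinate functionals. -/
lemma exists_coord (j : Fin m) : ∃ f : V →ₗ[ℝ] ℝ, ∀ i, f (S.root i) = if i = j then 1 else 0 := by
  classical
  obtain ⟨f, hf⟩ := LinearMap.exists_extend
    ((Finsupp.lapply j : (Fin m →₀ ℝ) →ₗ[ℝ] ℝ).comp S.root_indep.repr)
  refine ⟨f, fun i => ?_⟩
  have h := LinearMap.congr_fun hf ⟨S.root i, Submodule.subset_span ⟨i, rfl⟩⟩
  have h2 := S.root_indep.repr_eq_single i ⟨S.root i, Submodule.subset_span ⟨i, rfl⟩⟩ rfl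
  simp only [LinearMap.comp_apply, Submodule.subtype_apply, h2] at h
  rw [h]
  simp [Finsupp.single_apply]

lemma coord_nonneg {j : Fin m} {f : V →ₗ[ℝ] ℝ} (hf : ∀ i, f (S.root i) = if i = j then 1 else 0)
    {x : V} (hx : x ∈ S.cone) : 0 ≤ f x := by
  obtain ⟨c, hc, rfl⟩ := hx
  simpa [hf] using hc j

lemma cone_pointed {x : V} (hx : x ∈ S.cone) (hx' : -x ∈ S.cone) : x = 0 := by
  obtain ⟨c, hc, rfl⟩ := hx
  have : ∀ j, c j = 0 := by
    intro j
    obtain ⟨f, hf⟩ := S.exists_coord j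
    have h := S.coord_nonneg hf hx'
    simp [hf] at h
    exact le_antisymm h (hc j)
  simp [this]

lemma root_ne_zero (i : Fin m) : S.root i ≠ 0 := S.root_indep.ne_zero i

/-! ### Dihedral computations -/

/-- Alternating products `... s t` with `t` as the last letter. -/
def alt (a b : Fin m) : ℕ → (V ≃ₗ[ℝ] V)
  | 0 => 1
  | k + 1 => S.s (if Even k then b else a) * alt a b k

lemma alt_mem (a b : Fin m) (k : ℕ) : S.alt a b k ∈ S.W := by
  induction k with
  | zero => exact one_mem _
  | succ k ih => exact mul_mem (S.s_mem _) ih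

lemma len_alt_le (a b : Fin m) (k : ℕ) : S.len (S.alt a b k) ≤ k := by
  induction k with
  | zero => exact S.len_one.le
  | succ k ih =>
    have h1 := S.len_mul_le (S.s_mem (if Even k then b else a)) (S.alt_mem a b k)
    have h2 := S.len_s_le (if Even k then b else a)
    simp only [alt]; omega

lemma len_alt_s {a b : Fin m} {n : ℕ} (h : S.len (S.alt a b n * S.s a) + 1 ≤ n) (k : ℕ) (hk : n ≤ k) :
    S.len (S.alt a b k * S.s a) + 1 ≤ k := by
  induction k, hk using Nat.le_induction with
  | base => exact h
  | succ k hk ih =>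
    have h1 := S.len_mul_le (S.s_mem (if Even k then b else a))
      (mul_mem (S.alt_mem a b k) (S.s_mem a))
    have h2 := S.len_s_le (if Even k then b else a)
    simp only [alt, mul_assoc]; omega

/-- Either `alt k` maps the simple root `a` to a nonnegative combination of the two simple
roots, or `alt k` times `s a` is shorter than `k`. -/
lemma alt_dichotomy {a b : Fin m} (hab : a ≠ b) (k : ℕ) :
    (∃ A B : ℝ, 0 ≤ A ∧ 0 ≤ B ∧ S.alt a b k (S.root a) = A • S.root a + B • S.root b) ∨
    S.len (S.alt a b k * S.s a) + 1 ≤ k := by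
  obtain ⟨p, hp⟩ : ∃ p : ℤ, p = - S.A a b := ⟨_, rfl⟩
  obtain ⟨q, hq⟩ : ∃ q : ℤ, q = - S.A b a := ⟨_, rfl⟩
  have hp0 : 0 ≤ p := by have := S.A_offdiag a b hab; omega
  have hq0 : 0 ≤ q := by have := S.A_offdiag b a hab.symm; omega
  have hpq : p = 0 ↔ q = 0 := by have := S.A_zero_iff a b; rw [hp, hq]; simpa using this
  have haa := S.coroot_self a
  have hbb := S.coroot_self b
  have hab' : S.coroot a (S.root b) = -(p : ℝ) := by rw [S.pairing, hp]; simp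
  have hba' : S.coroot b (S.root a) = -(q : ℝ) := by rw [S.pairing, hq]; simp
  by_cases h4 : 4 ≤ p * q
  · left
    have h4' : (4 : ℝ) ≤ p * q := by exact_mod_cast h4
    have hp0' : (0 : ℝ) ≤ p := by exact_mod_cast hp0
    have hq0' : (0 : ℝ) ≤ q := by exact_mod_cast hq0
    suffices h : ∃ A B : ℝ, 0 ≤ A ∧ 0 ≤ B ∧
        S.alt a b k (S.root a) = A • S.root a + B • S.root b ∧
        (if Even k then p * B ≤ 2 * A else q * A ≤ 2 * B) by
      obtain ⟨A, B, h1, h2, h3, -⟩ := h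
      exact ⟨A, B, h1, h2, h3⟩
    induction k with
    | zero => exact ⟨1, 0, by simp, by simp, by simp [alt], by simp⟩
    | succ k ih =>
      obtain ⟨A, B, h1, h2, h3, h5⟩ := ih
      by_cases hk : Even k
      · have hk' : ¬ Even (k + 1) := by simpa [Nat.even_add_one] using hk
        simp only [hk, if_true] at h5
        simp only [hk', if_false]
        have h6 : 2 * B ≤ q * A := by nlinarith
        refine ⟨A, q * A - B, h1, by linarith, ?_, by linarith⟩
        simp only [alt, hk, if_true, LinearEquiv.mul_apply, h3, s_apply, map_add, map_smul, hbb,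
          hba', smul_eq_mul]
        module
      · have hk' : Even (k + 1) := by simpa [Nat.even_add_one] using hk
        simp only [hk, if_false] at h5
        simp only [hk', if_true]
        have h6 : 2 * A ≤ p * B := by nlinarith
        refine ⟨p * B - A, B, by linarith, h2, ?_, by linarith⟩
        simp only [alt, hk, if_false, LinearEquiv.mul_apply, h3, s_apply, map_add, map_smul, haa,
          hab', smul_eq_mul]
        module
  · have hcases : (p = 0 ∧ q = 0) ∨ (p = 1 ∧ q = 1) ∨ (p = 1 ∧ q = 2) ∨ (p = 2 ∧ q = 1) ∨
        (p = 1 ∧ q = 3) ∨ (p = 3 ∧ q = 1) := by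
      rcases hp0.eq_or_lt with h | h
      · left; exact ⟨h.symm, hpq.1 h.symm⟩
      · have hq1 : 0 < q := lt_of_le_of_ne hq0 (fun h' => h.ne' (hpq.2 h'.symm))
        have : p ≤ 3 := by nlinarith
        have : q ≤ 3 := by nlinarith
        interval_cases p <;> interval_cases q <;> simp at h4 ⊢
    have key : ∀ n : ℕ, (n ≤ k → ∃ l : List (Fin m), l.length + 1 ≤ n ∧
        S.alt a b n * S.s a = (l.map S.s).prod) → n ≤ k →
        S.len (S.alt a b k * S.s a) + 1 ≤ k := by
      intro n h hn
      obtain ⟨l, hl, e⟩ := h hn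
      refine S.len_alt_s (n := n) ?_ k hn
      have := S.len_prod_le l
      rw [e]; omega
    have e1 : S.alt a b 1 = S.s b := by simp [alt]
    have e2 : S.alt a b 2 = S.s a * S.s b := by simp [alt]
    have e3 : S.alt a b 3 = S.s b * (S.s a * S.s b) := by simp [alt, Nat.even_add_one]
    have e4 : S.alt a b 4 = S.s a * (S.s b * (S.s a * S.s b)) := by
      simp [alt, Nat.even_add_one]
    have e5 : S.alt a b 5 = S.s b * (S.s a * (S.s b * (S.s a * S.s b))) := by
      simp [alt, Nat.even_add_one]
    have e6 : S.alt a b 6 = S.s a * (S.s b * (S.s a * (S.s b * (S.s a * S.s b)))) := by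
      simp [alt, Nat.even_add_one]
    have sa : ∀ (v : V) (x y : ℝ), S.s a (v + x • S.root a + y • S.root b) =
        v + (-(S.coroot a v) - x + p * y) • S.root a + y • S.root b := by
      intro v x y
      simp only [s_apply, map_add, map_smul, haa, hab', smul_eq_mul]
      module
    have sb : ∀ (v : V) (x y : ℝ), S.s b (v + x • S.root a + y • S.root b) =
        v + x • S.root a + (-(S.coroot b v) - y + q * x) • S.root b := by
      intro v x y
      simp only [s_apply, map_add, map_smul, hbb, hba', smul_eq_mul]
      module
    have v0 : ∀ v : V, v = v + (0 : ℝ) • S.root a + (0 : ℝ) • S.root b := by intro v; simp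
    have r0 : S.root a = (0 : V) + (1 : ℝ) • S.root a + (0 : ℝ) • S.root b := by simp
    have fin : ∀ A B : ℝ, 0 ≤ A → 0 ≤ B →
        S.alt a b k (S.root a) = (0 : V) + A • S.root a + B • S.root b →
        ∃ A B : ℝ, 0 ≤ A ∧ 0 ≤ B ∧ S.alt a b k (S.root a) = A • S.root a + B • S.root b :=
      fun A B h1 h2 h3 => ⟨A, B, h1, h2, by rw [h3, zero_add]⟩
    have pos : ∀ n : ℕ, n ≤ 6 → k < n → (0 ≤ (q : ℝ)) →
        (2 < n → 1 ≤ (p : ℝ) * q) → (3 < n → 2 ≤ (p : ℝ) * q) →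
        (4 < n → 3 ≤ (p : ℝ) * q) →
        ∃ A B : ℝ, 0 ≤ A ∧ 0 ≤ B ∧ S.alt a b k (S.root a) = A • S.root a + B • S.root b := by
      intro n hn hk hq h2 h3 h4
      have hk6 : k < 6 := by omega
      interval_cases k
      · exact ⟨1, 0, by simp, by simp, by simp [alt]⟩
      · refine fin 1 q (by simp) hq ?_
        rw [e1]; nth_rw 1 [r0]; rw [sb]; simp
      · have := h2 hk
        refine fin (p * q - 1) q (by linarith) hq ?_
        rw [e2]; nth_rw 1 [r0]; simp only [LinearEquiv.mul_apply, sb, sa, map_zero]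
        module
      · have := h3 hk
        refine fin (p * q - 1) (q * (p * q - 2)) (by linarith) (mul_nonneg hq (by linarith)) ?_
        rw [e3]; nth_rw 1 [r0]; simp only [LinearEquiv.mul_apply, sb, sa, map_zero]
        module
      · have := h4 (by omega)
        refine fin ((p * q) * (p * q - 3) + 1) (q * (p * q - 2)) (by nlinarith)
          (mul_nonneg hq (by linarith)) ?_
        rw [e4]; nth_rw 1 [r0]; simp only [LinearEquiv.mul_apply, sb, sa, map_zero]
        module
      · have := h4 (by omega)
        refine fin ((p * q) * (p * q - 3) + 1) (q * ((p * q - 1) * (p * q - 3))) (by nlinarith)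
          (mul_nonneg hq (mul_nonneg (by linarith) (by linarith))) ?_
        rw [e5]; nth_rw 1 [r0]; simp only [LinearEquiv.mul_apply, sb, sa, map_zero]
        module
    rcases hcases with ⟨rfl, rfl⟩ | ⟨rfl, rfl⟩ | ⟨rfl, rfl⟩ | ⟨rfl, rfl⟩ | ⟨rfl, rfl⟩ | ⟨rfl, rfl⟩
    · rcases lt_or_ge k 2 with hk | hk
      · left
        exact pos 2 (by norm_num) hk (by norm_num) (by norm_num) (by norm_num) (by norm_num)
      · right
        refine key 2 (fun _ => ⟨[b], by simp, ?_⟩) hk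
        rw [e2]
        ext v
        rw [v0 v]
        simp only [LinearEquiv.mul_apply, sb, sa, List.map_cons, List.map_nil, List.prod_cons,
          List.prod_nil, LinearEquiv.coe_one, id, mul_one]
        push_cast
        module
    · rcases lt_or_ge k 3 with hk | hk
      · left
        exact pos 3 (by norm_num) hk (by norm_num) (by norm_num) (by norm_num) (by norm_num)
      · right
        refine key 3 (fun _ => ⟨[a, b], by simp, ?_⟩) hk
        rw [e3]
        ext v
        rw [v0 v]
        simp only [LinearEquiv.mul_apply, sb, sa, List.map_cons, List.map_nil, List.prod_cons,
          List.prod_nil, LinearEquiv.coe_one, id, mul_one]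
        push_cast
        module
    iterate 2
      rcases lt_or_ge k 4 with hk | hk
      · left
        exact pos 4 (by norm_num) hk (by norm_num) (by norm_num) (by norm_num) (by norm_num)
      · right
        refine key 4 (fun _ => ⟨[b, a, b], by simp, ?_⟩) hk
        rw [e4]
        ext v
        rw [v0 v]
        simp only [LinearEquiv.mul_apply, sb, sa, List.map_cons, List.map_nil, List.prod_cons,
          List.prod_nil, LinearEquiv.coe_one, id, mul_one]
        push_cast
        module
    iterate 2
      rcases lt_or_ge k 6 with hk | hk
      · left
        exact pos 6 (by norm_num) hk (by norm_num) (by norm_num) (by norm_num) (by norm_num)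
      · right
        refine key 6 (fun _ => ⟨[b, a, b, a, b], by simp, ?_⟩) hk
        rw [e6]
        ext v
        rw [v0 v]
        simp only [LinearEquiv.mul_apply, sb, sa, List.map_cons, List.map_nil, List.prod_cons,
          List.prod_nil, LinearEquiv.coe_one, id, mul_one]
        push_cast
        module

/-! ### Positivity of roots -/

/-- If `w s` is not shorter than `w`, then `w` maps the simple root of `s` into the cone. -/
theorem pos_of_len_le : ∀ (n : ℕ) (w : V ≃ₗ[ℝ] V), w ∈ S.W → S.len w = n → ∀ a : Fin m,
    S.len w ≤ S.len (w * S.s a) → w (S.root a) ∈ S.cone := by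
  intro n
  induction n using Nat.strong_induction_on with
  | _ n ih =>
  intro w hw hn a ha
  by_cases h1 : w = 1
  · subst h1; exact S.root_mem_cone a
  obtain ⟨b, w', hw', e, hlen⟩ := S.exists_last hw h1
  have hab : a ≠ b := by
    rintro rfl
    rw [e, mul_assoc, s_sq, mul_one, ← e] at ha
    omega
  -- the maximal alternating suffix
  obtain ⟨k, hk1, ⟨v, hv, ev, hvk⟩, hmax⟩ : ∃ k, 1 ≤ k ∧
      (∃ v ∈ S.W, w = v * S.alt a b k ∧ S.len v + k = n) ∧
      ¬ (∃ v ∈ S.W, w = v * S.alt a b (k + 1) ∧ S.len v + (k + 1) = n) := by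
    by_contra hcon
    push Not at hcon
    have hall : ∀ k, 1 ≤ k → ∃ v ∈ S.W, w = v * S.alt a b k ∧ S.len v + k = n := by
      intro k hk
      induction k, hk using Nat.le_induction with
      | base => exact ⟨w', hw', by simpa [alt] using e, by omega⟩
      | succ k hk ihk => exact hcon k hk ihk
    obtain ⟨v, -, -, h⟩ := hall (n + 1) (by omega)
    omega
  -- both letters do not shorten `v`
  have hx : S.len v ≤ S.len (v * S.s (if Even k then b else a)) := by
    by_contra hlt
    push Not at hlt
    apply hmax
    refine ⟨_, mul_mem hv (S.s_mem (if Even k then b else a)), ?_, ?_⟩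
    · simp only [alt]
      rw [ev, mul_assoc, ← mul_assoc (S.s _) (S.s _), s_sq, one_mul]
    · have h3 := S.len_mul_le (mul_mem hv (S.s_mem (if Even k then b else a)))
        (S.s_mem (if Even k then b else a))
      rw [mul_assoc, s_sq, mul_one] at h3
      have h4 := S.len_s_le (if Even k then b else a)
      omega
  have hy : S.len v ≤ S.len (v * S.s (if Even k then a else b)) := by
    by_contra hlt
    push Not at hlt
    obtain ⟨j, rfl⟩ : ∃ j, k = j + 1 := ⟨k - 1, by omega⟩
    have hE : (if Even (j + 1) then a else b) = (if Even j then b else a) := by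
      by_cases hj : Even j <;> simp [Nat.even_add_one, hj]
    rw [hE] at hlt
    simp only [alt] at ev
    rw [← mul_assoc] at ev
    have h3 := S.len_mul_le (mul_mem hv (S.s_mem (if Even j then b else a))) (S.alt_mem a b j)
    rw [← ev] at h3
    have h4 := S.len_alt_le a b j
    omega
  have hva : v (S.root a) ∈ S.cone := by
    apply ih (S.len v) (by omega) v hv rfl
    by_cases hk : Even k
    · simpa [hk] using hy
    · simpa [hk] using hx
  have hvb : v (S.root b) ∈ S.cone := by
    apply ih (S.len v) (by omega) v hv rfl
    by_cases hk : Even k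
    · simpa [hk] using hx
    · simpa [hk] using hy
  rcases S.alt_dichotomy hab k with ⟨A, B, hA, hB, h⟩ | h
  · rw [ev, LinearEquiv.mul_apply, h, map_add, map_smul, map_smul]
    exact S.add_mem_cone (S.smul_mem_cone hA hva) (S.smul_mem_cone hB hvb)
  · exfalso
    have h3 := S.len_mul_le hv (mul_mem (S.alt_mem a b k) (S.s_mem a))
    rw [← mul_assoc, ← ev] at h3
    omega

lemma pos_of_len {w : V ≃ₗ[ℝ] V} (hw : w ∈ S.W) (a : Fin m)
    (h : S.len w ≤ S.len (w * S.s a)) : w (S.root a) ∈ S.cone :=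
  S.pos_of_len_le _ w hw rfl a h

/-- A nontrivial element maps some simple root to a negative one. -/
lemma exists_neg {w : V ≃ₗ[ℝ] V} (hw : w ∈ S.W) (h1 : w ≠ 1) :
    ∃ t, - w (S.root t) ∈ S.cone := by
  obtain ⟨t, w', hw', e, hlen⟩ := S.exists_last hw h1
  refine ⟨t, ?_⟩
  have := S.pos_of_len hw' t (by rw [← e]; omega)
  have h2 : w (S.root t) = - w' (S.root t) := by
    rw [e, LinearEquiv.mul_apply, s_apply, coroot_self, ← map_neg]
    congr 1
    module
  rw [h2, neg_neg]
  exact this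

/-- The orbit of a dominant vector lies below it. -/
lemma sub_mem_cone {μ : V} (hμ : μ ∈ S.chamber) : ∀ (n : ℕ) (w : V ≃ₗ[ℝ] V), w ∈ S.W →
    S.len w = n → μ - w μ ∈ S.cone := by
  intro n
  induction n with
  | zero =>
    intro w hw hn
    by_cases h1 : w = 1
    · subst h1; simpa using S.zero_mem_cone
    · obtain ⟨t, w', hw', e, hlen⟩ := S.exists_last hw h1
      omega
  | succ n ih =>
    intro w hw hn
    have h1 : w ≠ 1 := by rintro rfl; rw [len_one] at hn; omega
    obtain ⟨t, w', hw', e, hlen⟩ := S.exists_last hw h1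
    have h2 := ih w' hw' (by omega)
    have h3 := S.pos_of_len hw' t (by rw [← e]; omega)
    have h4 : μ - w μ = (μ - w' μ) + S.coroot t μ • w' (S.root t) := by
      rw [e, LinearEquiv.mul_apply, s_apply, map_sub, map_smul]; abel
    rw [h4]
    exact S.add_mem_cone h2 (S.smul_mem_cone (hμ t) h3)

lemma orbit_le {μ : V} (hμ : μ ∈ S.chamber) {w : V ≃ₗ[ℝ] V} (hw : w ∈ S.W) :
    μ - w μ ∈ S.cone := S.sub_mem_cone hμ _ w hw rfl

lemma hull_le {μ : V} (hμ : μ ∈ S.chamber) {x : V} (hx : x ∈ S.orbitHull μ) :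
    μ - x ∈ S.cone := by
  have : S.orbitHull μ ⊆ {x | μ - x ∈ S.cone} := by
    apply convexHull_min
    · rintro _ ⟨w, hw, rfl⟩
      exact S.orbit_le hμ hw
    · intro x hx y hy a b ha hb hab
      have h : μ - (a • x + b • y) = a • (μ - x) + b • (μ - y) := by
        have : μ = (a + b) • μ := by rw [hab, one_smul]
        nth_rw 1 [this]
        module
      change μ - (a • x + b • y) ∈ S.cone
      rw [h]
      exact S.add_mem_cone (S.smul_mem_cone ha hx) (S.smul_mem_cone hb hy)
  exact this hx

lemma orbit_mem_hull {μ : V} {w : V ≃ₗ[ℝ] V} (hw : w ∈ S.W) : w μ ∈ S.orbitHull μ :=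
  subset_convexHull ℝ _ ⟨w, hw, rfl⟩

lemma self_mem_hull {μ : V} : μ ∈ S.orbitHull μ := S.orbit_mem_hull (w := 1) (one_mem _)

lemma hull_stable {μ : V} {w : V ≃ₗ[ℝ] V} (hw : w ∈ S.W) {x : V} (hx : x ∈ S.orbitHull μ) :
    w x ∈ S.orbitHull μ := by
  have : S.orbitHull μ ⊆ w.toLinearMap ⁻¹' S.orbitHull μ := by
    apply convexHull_min
    · rintro _ ⟨u, hu, rfl⟩
      exact S.orbit_mem_hull (μ := μ) (mul_mem hw hu)
    · exact (convex_convexHull ℝ _).linear_preimage w.toLinearMap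
  exact this hx

lemma fix_mu {μ : V} {w : V ≃ₗ[ℝ] V} (hw : w ∈ S.WI (S.J0 μ)) : w μ = μ := by
  induction hw using Subgroup.closure_induction with
  | mem x hx =>
    obtain ⟨i, hi, rfl⟩ := hx
    rw [s_apply, show S.coroot i μ = 0 from hi]; simp
  | one => rfl
  | mul x y _ _ hx hy => rw [LinearEquiv.mul_apply, hy, hx]
  | inv x _ hx => nth_rw 1 [← hx]; rw [← LinearEquiv.mul_apply, inv_mul_cancel]; rfl

/-- Functionals vanishing on the simple roots of `I` are invariant under `W_I`. -/
lemma coord_inv {I : Set (Fin m)} {f : V →ₗ[ℝ] ℝ} (hf : ∀ i ∈ I, f (S.root i) = 0)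
    {w : V ≃ₗ[ℝ] V} (hw : w ∈ S.WI I) (v : V) : f (w v) = f v := by
  induction hw using Subgroup.closure_induction generalizing v with
  | mem x hx =>
    obtain ⟨i, hi, rfl⟩ := hx
    rw [s_apply, map_sub, map_smul, hf i hi]; simp
  | one => rfl
  | mul x y _ _ hx hy => rw [LinearEquiv.mul_apply, hx, hy]
  | inv x _ hx =>
    rw [← hx (x⁻¹ v), ← LinearEquiv.mul_apply, mul_inv_cancel]; rfl

/-- An element of `W_I` fixing all simple roots of `I` is trivial. -/
lemma eq_one_of_fix {I : Set (Fin m)} {w : V ≃ₗ[ℝ] V} (hw : w ∈ S.WI I)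
    (h : ∀ i ∈ I, w (S.root i) = S.root i) : w = 1 := by
  by_contra h1
  obtain ⟨t, ht⟩ := S.exists_neg (S.WI_le I hw) h1
  by_cases hI : t ∈ I
  · rw [h t hI] at ht
    exact S.root_ne_zero t (S.cone_pointed (S.root_mem_cone t) ht)
  · obtain ⟨f, hf⟩ := S.exists_coord t
    have h2 := S.coord_nonneg hf ht
    rw [map_neg, S.coord_inv (f := f) _ hw, hf] at h2
    · simp at h2; linarith
    · intro i hi
      rw [hf, if_neg]
      rintro rfl; exact hI hi

/-! ### Infinite orbits -/

lemma finite_of_orbit {C : Set (Fin m)} (j k : Fin m) (hk : k ∈ C)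
    (hkj : S.coroot k (S.root j) ≠ 0)
    (hconn : ∀ c ∈ C, ∃ (hk : k ∈ C) (hc : c ∈ C),
      (S.diagram.induce C).Reachable ⟨k, hk⟩ ⟨c, hc⟩)
    (hfin : {v | ∃ u ∈ S.WI C, v = u (S.root j)}.Finite) : S.FiniteType C := by
  set O := {v | ∃ u ∈ S.WI C, v = u (S.root j)} with hO
  have hs : ∀ c ∈ C, S.s c ∈ S.WI C := fun c hc => Subgroup.subset_closure ⟨c, hc, rfl⟩
  have hOst : ∀ u ∈ S.WI C, ∀ v ∈ O, u v ∈ O := by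
    rintro u hu _ ⟨w, hw, rfl⟩
    exact ⟨u * w, mul_mem hu hw, rfl⟩
  -- the span of the orbit is stable
  have hst : ∀ u ∈ S.WI C, ∀ v ∈ Submodule.span ℝ O, u v ∈ Submodule.span ℝ O := by
    intro u hu v hv
    have : Submodule.span ℝ O ≤ (Submodule.span ℝ O).comap u.toLinearMap := by
      rw [Submodule.span_le]
      intro x hx
      exact Submodule.subset_span (hOst u hu x hx)
    exact this hv
  have hstep : ∀ c ∈ C, ∀ v ∈ Submodule.span ℝ O, S.coroot c v ≠ 0 →
      S.root c ∈ Submodule.span ℝ O := by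
    intro c hc v hv hne
    have h1 := Submodule.sub_mem _ hv (hst _ (hs c hc) v hv)
    rw [s_apply, sub_sub_cancel] at h1
    have h2 := Submodule.smul_mem _ (S.coroot c v)⁻¹ h1
    rwa [smul_smul, inv_mul_cancel₀ hne, one_smul] at h2
  have hk0 : S.root k ∈ Submodule.span ℝ O :=
    hstep k hk (S.root j) (Submodule.subset_span ⟨1, one_mem _, rfl⟩) hkj
  have hwalk : ∀ x y : C, (S.diagram.induce C).Reachable x y →
      S.root x ∈ Submodule.span ℝ O → S.root y ∈ Submodule.span ℝ O := by
    rintro x y ⟨p⟩ hx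
    induction p with
    | nil => exact hx
    | cons hadj p ih =>
      rename_i x y z
      apply ih
      refine hstep y y.2 _ hx ?_
      have : S.Adjacent x y := hadj
      rw [S.pairing]
      exact_mod_cast this.2.2
  have hall : ∀ c ∈ C, S.root c ∈ Submodule.span ℝ O := by
    intro c hc
    obtain ⟨hk, hc, h⟩ := hconn c hc
    exact hwalk _ _ h hk0
  -- injectivity of restriction to the orbit
  have : Finite O := hfin
  let φ : S.WI C → (O → O) := fun u v => ⟨u.1 v.1, hOst u.1 u.2 v.1 v.2⟩
  have hφ : Function.Injective φ := by
    intro u u' h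
    have h1 : ∀ v ∈ O, u.1 v = u'.1 v := fun v hv => congrArg Subtype.val (congrFun h ⟨v, hv⟩)
    have h2 : ∀ v ∈ Submodule.span ℝ O, u.1 v = u'.1 v := by
      have : Submodule.span ℝ O ≤ LinearMap.eqLocus u.1.toLinearMap u'.1.toLinearMap := by
        rw [Submodule.span_le]; exact h1
      exact fun v hv => this hv
    have h3 : u.1⁻¹ * u'.1 = 1 := by
      apply S.eq_one_of_fix (I := C) (mul_mem (inv_mem u.2) u'.2)
      intro i hi
      rw [LinearEquiv.mul_apply, ← h2 _ (hall i hi), ← LinearEquiv.mul_apply, inv_mul_cancel]; rfl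
    exact Subtype.ext (inv_mul_eq_one.1 h3)
  have : Finite (S.WI C) := Finite.of_injective φ hφ
  exact Set.toFinite _

/-! ### Finite orbits -/

lemma commute_of_not_adj {i j : Fin m} (h : S.A i j = 0) : Commute (S.s i) (S.s j) := by
  have h1 : S.coroot i (S.root j) = 0 := by rw [S.pairing, h]; simp
  have h2 : S.coroot j (S.root i) = 0 := by rw [S.pairing, (S.A_zero_iff i j).1 h]; simp
  ext v
  simp only [LinearEquiv.mul_apply, s_apply, map_sub, map_smul, h1, h2]
  module

lemma finite_of_comps {K : Set (Fin m)} (h : S.FinTypeComponents K) : S.FiniteType K := by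
  classical
  let G := S.diagram.induce K
  let H : G.ConnectedComponent → Subgroup (V ≃ₗ[ℝ] V) :=
    fun c => S.WI (Subtype.val '' c.supp)
  have hcomm : Pairwise fun c d => ∀ x y : V ≃ₗ[ℝ] V, x ∈ H c → y ∈ H d → Commute x y := by
    intro c d hcd x y hx hy
    have hgen : ∀ i ∈ c.supp, ∀ j ∈ d.supp, Commute (S.s i.1) (S.s j.1) := by
      intro i hi j hj
      apply S.commute_of_not_adj
      by_contra hne
      have hij : G.Adj i j := by
        refine ⟨?_, hne, fun h => hne ((S.A_zero_iff _ _).2 h)⟩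
        intro e
        have : i = j := Subtype.ext e
        subst this
        exact hcd (hi.symm.trans hj)
      exact hcd (hi.symm.trans ((SimpleGraph.ConnectedComponent.eq.2 hij.reachable).trans hj))
    have h1 : ∀ j ∈ d.supp, ∀ x ∈ H c, Commute x (S.s j.1) := by
      intro j hj x hx
      have : H c ≤ Subgroup.centralizer {S.s j.1} := by
        refine (Subgroup.closure_le _).2 ?_
        rintro _ ⟨_, ⟨i, hi, rfl⟩, rfl⟩
        rw [SetLike.mem_coe, Subgroup.mem_centralizer_singleton_iff]
        exact (hgen i hi j hj)
      exact (Subgroup.mem_centralizer_singleton_iff.1 (this hx))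
    have : H d ≤ Subgroup.centralizer {x} := by
      refine (Subgroup.closure_le _).2 ?_
      rintro _ ⟨_, ⟨j, hj, rfl⟩, rfl⟩
      rw [SetLike.mem_coe, Subgroup.mem_centralizer_singleton_iff]
      exact (h1 j hj x hx).symm
    exact (Subgroup.mem_centralizer_singleton_iff.1 (this hy)).symm
  have hfin : ∀ c, Finite (H c) := by
    intro c
    induction c using SimpleGraph.ConnectedComponent.ind with
    | _ i =>
    have : S.comp K i = Subtype.val '' (G.connectedComponentMk i).supp := by
      ext j
      constructor
      · rintro ⟨hi, hj, hr⟩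
        exact ⟨⟨j, hj⟩, SimpleGraph.ConnectedComponent.eq.2 hr.symm, rfl⟩
      · rintro ⟨⟨j, hj⟩, hr, rfl⟩
        exact ⟨i.2, hj, (SimpleGraph.ConnectedComponent.eq.1 hr).symm⟩
    have h2 := h i i.2
    rw [this] at h2
    exact h2
  have : Finite G.ConnectedComponent := Quot.finite _
  have : Fintype G.ConnectedComponent := Fintype.ofFinite _
  have hle : S.WI K ≤ (Subgroup.noncommPiCoprod hcomm).range := by
    rw [Subgroup.noncommPiCoprod_range]
    refine (Subgroup.closure_le _).2 ?_
    rintro _ ⟨i, hi, rfl⟩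
    refine (le_iSup H (G.connectedComponentMk ⟨i, hi⟩)) ?_
    exact Subgroup.subset_closure ⟨i, ⟨⟨i, hi⟩, rfl, rfl⟩, rfl⟩
  have hr : ((Subgroup.noncommPiCoprod hcomm).range : Set (V ≃ₗ[ℝ] V)).Finite := by
    rw [MonoidHom.coe_range]
    exact Set.finite_range _
  exact hr.subset hle

lemma len_inv_le {w : V ≃ₗ[ℝ] V} (hw : w ∈ S.W) : S.len w⁻¹ ≤ S.len w := by
  obtain ⟨l, hl, e⟩ := S.exists_reduced hw
  have h1 : w⁻¹ = (l.reverse.map S.s).prod := by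
    rw [e, List.prod_inv_reverse, List.map_map, ← List.map_reverse]
    congr 1
  have h2 := S.len_prod_le l.reverse
  rw [← h1, List.length_reverse, hl] at h2
  exact h2

lemma mem_muPart_of_ne {μ : V} {j : Fin m} (h : S.coroot j μ ≠ 0) : j ∈ S.muPart μ Set.univ :=
  ⟨Set.mem_univ _, j, Set.mem_univ _, h, SimpleGraph.Reachable.refl _⟩

lemma mem_muPart_of_adj {μ : V} {i j : Fin m} (hi : i ∈ S.muPart μ Set.univ) (h : S.Adjacent j i) :
    j ∈ S.muPart μ Set.univ := by
  obtain ⟨hi, k, hk, hk0, hr⟩ := hi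
  refine ⟨Set.mem_univ _, k, hk, hk0, SimpleGraph.Reachable.trans ?_ hr⟩
  apply SimpleGraph.Adj.reachable
  exact h

/-- The `W_{J₀}`-orbit of a simple root of `Π*` agrees with its `W_{Π* ∩ J₀}`-orbit. -/
lemma orbit_reduce {μ : V} {i : Fin m} (hi : i ∈ S.muPart μ Set.univ) {u : V ≃ₗ[ℝ] V}
    (hu : u ∈ S.WI (S.J0 μ)) :
    ∃ u' ∈ S.WI (S.muPart μ Set.univ ∩ S.J0 μ), u (S.root i) = u' (S.root i) := by
  set P := S.muPart μ Set.univ with hP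
  set U := Submodule.span ℝ (S.root '' P) with hU
  have hst : ∀ w ∈ S.WI (P ∩ S.J0 μ), w (S.root i) ∈ U := by
    intro w hw
    induction hw using Subgroup.closure_induction_left with
    | one => exact Submodule.subset_span ⟨i, hi, rfl⟩
    | mul_left x hx y hy ih =>
      obtain ⟨j, hj, rfl⟩ := hx
      rw [LinearEquiv.mul_apply, s_apply]
      exact U.sub_mem ih (U.smul_mem _ (Submodule.subset_span ⟨j, hj.1, rfl⟩))
    | inv_mul_cancel x hx y hy ih =>
      obtain ⟨j, hj, rfl⟩ := hx
      rw [s_inv, LinearEquiv.mul_apply, s_apply]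
      exact U.sub_mem ih (U.smul_mem _ (Submodule.subset_span ⟨j, hj.1, rfl⟩))
  have hfix : ∀ j, j ∉ P → ∀ v ∈ U, S.s j v = v := by
    intro j hj v hv
    have : U ≤ LinearMap.ker (S.coroot j) := by
      rw [hU, Submodule.span_le]
      rintro _ ⟨p, hp, rfl⟩
      rw [SetLike.mem_coe, LinearMap.mem_ker, S.pairing]
      by_contra hne
      have hne' : S.A j p ≠ 0 := by exact_mod_cast hne
      refine hj (S.mem_muPart_of_adj hp ⟨?_, hne', fun h => hne' ((S.A_zero_iff _ _).2 h)⟩)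
      rintro rfl; exact hj hp
    rw [s_apply, LinearMap.mem_ker.1 (this hv)]; simp
  have step : ∀ j ∈ S.J0 μ, ∀ y : V ≃ₗ[ℝ] V,
      (∃ u' ∈ S.WI (P ∩ S.J0 μ), y (S.root i) = u' (S.root i)) →
      ∃ u' ∈ S.WI (P ∩ S.J0 μ), (S.s j * y) (S.root i) = u' (S.root i) := by
    rintro j hj y ⟨y', hy', e⟩
    by_cases hjP : j ∈ P
    · exact ⟨S.s j * y', mul_mem (Subgroup.subset_closure ⟨j, ⟨hjP, hj⟩, rfl⟩) hy', by
        rw [LinearEquiv.mul_apply, e, LinearEquiv.mul_apply]⟩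
    · exact ⟨y', hy', by rw [LinearEquiv.mul_apply, e, hfix j hjP _ (hst y' hy')]⟩
  induction hu using Subgroup.closure_induction_left with
  | one => exact ⟨1, one_mem _, rfl⟩
  | mul_left x hx y hy ih =>
    obtain ⟨j, hj, rfl⟩ := hx
    exact step j hj y ih
  | inv_mul_cancel x hx y hy ih =>
    obtain ⟨j, hj, rfl⟩ := hx
    rw [s_inv]
    exact step j hj y ih

/-! ### Edges through `μ` -/

lemma exists_orbit_mem {μ : V} {E : Set V} (hE : IsExtreme ℝ (S.orbitHull μ) E)
    (hdim : finrank ℝ (vectorSpan ℝ E) = 1) : ∃ w ∈ S.W, w μ ≠ μ ∧ w μ ∈ E := by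
  by_contra hcon
  push Not at hcon
  have hsub : S.orbitHull μ ⊆ {x | x ∈ S.orbitHull μ ∧ (x ∈ E → x = μ)} := by
    apply convexHull_min
    · rintro _ ⟨w, hw, rfl⟩
      refine ⟨S.orbit_mem_hull hw, fun h => ?_⟩
      by_contra hne
      exact hcon w hw hne h
    · rw [convex_iff_forall_pos]
      intro x hx y hy a b ha hb hab
      refine ⟨convex_convexHull ℝ _ hx.1 hy.1 ha.le hb.le hab, fun h => ?_⟩
      have hz : a • x + b • y ∈ openSegment ℝ x y := ⟨a, b, ha, hb, hab, rfl⟩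
      rw [hx.2 (hE.left_mem_of_mem_openSegment hx.1 hy.1 h hz),
        hy.2 (hE.right_mem_of_mem_openSegment hx.1 hy.1 h hz), ← add_smul, hab, one_smul]
  have hss : E.Subsingleton := fun x hx y hy =>
    ((hsub (hE.subset hx)).2 hx).trans ((hsub (hE.subset hy)).2 hy).symm
  rw [vectorSpan_of_subsingleton ℝ hss] at hdim
  simp at hdim

lemma edge_direction {μ : V} (hμ : μ ∈ S.chamber) {E : Set V}
    (hE : IsFaceOf (S.orbitHull μ) E) (hdim : finrank ℝ (vectorSpan ℝ E) = 1) (hμE : μ ∈ E) :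
    ∃ u ∈ S.WI (S.J0 μ), ∃ i, 0 < S.coroot i μ ∧ μ - S.coroot i μ • u (S.root i) ∈ E := by
  classical
  obtain ⟨hconv, hext⟩ := hE
  have hex : ∃ n, ∃ w ∈ S.W, ∃ u ∈ S.WI (S.J0 μ), S.len w = n ∧ w μ ≠ μ ∧ u (w μ) ∈ E := by
    obtain ⟨w, hw, hne, hwE⟩ := S.exists_orbit_mem hext hdim
    exact ⟨_, w, hw, 1, one_mem _, rfl, hne, hwE⟩
  obtain ⟨w, hw, u, hu, hlen, hne, hwE⟩ := Nat.find_spec hex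
  have hmin := fun k => @Nat.find_min _ _ hex k
  rw [← hlen] at hmin
  have hdom : ∀ j ∈ S.J0 μ, 0 ≤ S.coroot j (w μ) := by
    intro j hj
    have hsμ : S.s j μ = μ := S.fix_mu (Subgroup.subset_closure ⟨j, hj, rfl⟩)
    have hle : S.len w ≤ S.len (S.s j * w) := by
      by_contra hlt
      push Not at hlt
      refine hmin _ hlt ⟨S.s j * w, mul_mem (S.s_mem j) hw, u * S.s j,
        mul_mem hu (Subgroup.subset_closure ⟨j, hj, rfl⟩), rfl, ?_, ?_⟩
      · intro h
        apply hne
        rw [LinearEquiv.mul_apply, ← hsμ] at h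
        have := (S.s j).injective h
        rwa [hsμ] at this
      · rw [← LinearEquiv.mul_apply, mul_assoc, ← mul_assoc (S.s j), s_sq, one_mul]
        exact hwE
    have hinv : S.len w⁻¹ ≤ S.len (w⁻¹ * S.s j) := by
      have h1 := S.len_inv_le hw
      have h2 := S.len_inv_le (mul_mem (inv_mem hw) (S.s_mem j))
      rw [mul_inv_rev, inv_inv, s_inv] at h2
      omega
    have hpos := S.pos_of_len (inv_mem hw) j hinv
    have h3 := S.orbit_le hμ (mul_mem (inv_mem hw) (mul_mem (S.s_mem j) hw))
    have h4 : μ - (w⁻¹ * (S.s j * w)) μ = S.coroot j (w μ) • w⁻¹ (S.root j) := by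
      rw [LinearEquiv.mul_apply, LinearEquiv.mul_apply, s_apply, map_sub, map_smul,
        ← LinearEquiv.mul_apply w⁻¹ w, inv_mul_cancel]
      simp
    rw [h4] at h3
    by_contra hneg
    push Not at hneg
    have h5 := S.smul_mem_cone (a := -(S.coroot j (w μ))⁻¹)
      (by rw [neg_nonneg]; exact (inv_lt_zero.2 hneg).le) h3
    rw [smul_smul, neg_mul, inv_mul_cancel₀ hneg.ne, neg_one_smul] at h5
    have h6 := S.cone_pointed hpos h5
    exact S.root_ne_zero j ((w⁻¹).map_eq_zero_iff.1 h6)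
  obtain ⟨i, hi⟩ : ∃ i, S.coroot i (w μ) < 0 := by
    by_contra hcon
    push Not at hcon
    have h1 := S.orbit_le (μ := w μ) hcon (inv_mem hw)
    rw [← LinearEquiv.mul_apply, inv_mul_cancel] at h1
    have h2 := S.orbit_le hμ hw
    have h3 := S.cone_pointed h2 (by rw [neg_sub]; exact h1)
    exact hne (sub_eq_zero.1 h3).symm
  have hiμ : 0 < S.coroot i μ := by
    rcases (hμ i).eq_or_lt with h | h
    · exact absurd (hdom i h.symm) (not_le.2 hi)
    · exact h
  refine ⟨u, hu, i, hiμ, ?_⟩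
  have huW := S.WI_le _ hu
  have huμ := S.fix_mu hu
  set a := S.coroot i μ with ha
  obtain ⟨b, hb⟩ : ∃ b, b = - S.coroot i (w μ) := ⟨_, rfl⟩
  have hb0 : 0 < b := by linarith
  have hab : a + b ≠ 0 := by positivity
  have hp : (b / (a + b)) • μ + (a / (a + b)) • u (w μ) ∈ E :=
    hconv hμE hwE (by positivity) (by positivity) (by field_simp; ring)
  have e1 : u (S.s i μ) = μ - a • u (S.root i) := by
    rw [s_apply, map_sub, map_smul, huμ]
  have e2 : u (S.s i (w μ)) = u (w μ) + b • u (S.root i) := by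
    rw [s_apply, map_sub, map_smul, hb, neg_smul, sub_eq_add_neg]
  have hm1 : μ - a • u (S.root i) ∈ S.orbitHull μ := by
    rw [← e1]; exact S.hull_stable huW (S.orbit_mem_hull (S.s_mem i))
  have hm2 : u (w μ) + b • u (S.root i) ∈ S.orbitHull μ := by
    rw [← e2]; exact S.hull_stable huW (S.hull_stable (S.s_mem i) (S.orbit_mem_hull hw))
  refine hext.left_mem_of_mem_openSegment hm1 hm2 hp ⟨b / (a + b), a / (a + b), by positivity,
    by positivity, by field_simp; ring, ?_⟩
  match_scalars <;> field_simp
  all_goals ring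

lemma edge_eq {μ : V} {E : Set V}
    (hE : IsFaceOf (S.orbitHull μ) E) (hdim : finrank ℝ (vectorSpan ℝ E) = 1) (hμE : μ ∈ E)
    {d : V} (hd : d ≠ 0) {a : ℝ} (ha : 0 < a) (hy : μ - a • d ∈ E) :
    E = S.orbitHull μ ∩ {x | ∃ t : ℝ, x = μ + t • d} := by
  obtain ⟨hconv, hext⟩ := hE
  ext x
  constructor
  · intro hx
    refine ⟨hext.subset hx, ?_⟩
    have h1 : d ∈ vectorSpan ℝ E := by
      have h := vsub_mem_vectorSpan ℝ hμE hy
      rw [vsub_eq_sub, sub_sub_cancel] at h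
      have h2 := Submodule.smul_mem _ a⁻¹ h
      rwa [smul_smul, inv_mul_cancel₀ ha.ne', one_smul] at h2
    have h2 : x - μ ∈ vectorSpan ℝ E := vsub_mem_vectorSpan ℝ hx hμE
    obtain ⟨t, ht⟩ := (finrank_eq_one_iff_of_nonzero' (⟨d, h1⟩ : vectorSpan ℝ E)
      (fun h => hd (congrArg Subtype.val h))).1 hdim ⟨x - μ, h2⟩
    refine ⟨t, ?_⟩
    have h3 : t • d = x - μ := congrArg Subtype.val ht
    rw [h3]; abel
  · rintro ⟨hxH, t, rfl⟩
    rcases lt_trichotomy 0 t with ht | ht | ht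
    · refine hext.left_mem_of_mem_openSegment hxH (hext.subset hy) hμE
        ⟨a / (a + t), t / (a + t), by positivity, by positivity, by field_simp, ?_⟩
      match_scalars <;> field_simp
      all_goals ring
    · rw [← ht]; simpa using hμE
    · rcases le_or_gt (-a) t with h | h
      · have h2 := hconv hμE hy (a := 1 + t / a) (b := - t / a)
          (by rw [← neg_le_iff_add_nonneg', neg_le, ← neg_div, div_le_one ha]; linarith)
          (by rw [neg_div]; rw [neg_nonneg]; exact div_nonpos_of_nonpos_of_nonneg ht.le ha.le)
          (by ring)
        convert h2 using 1
        match_scalars <;> field_simp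
        all_goals ring
      · refine hext.right_mem_of_mem_openSegment S.self_mem_hull hxH hy
          ⟨1 - a / (-t), a / (-t), ?_, ?_, by ring, ?_⟩
        · rw [sub_pos, div_lt_one (by linarith)]; linarith
        · exact div_pos ha (by linarith)
        · have := ht.ne
          match_scalars <;> field_simp
          all_goals ring

/-- The edges `H ∩ (μ - ℝ₊ u α_j)`. -/
lemma edge_isFace {μ : V} (hμ : μ ∈ S.chamber) {u : V ≃ₗ[ℝ] V} (hu : u ∈ S.WI (S.J0 μ))
    {j : Fin m} (hj : 0 < S.coroot j μ) {F : Set V}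
    (hF : F = S.orbitHull μ ∩ {x | ∃ t : ℝ, 0 ≤ t ∧ x = μ - t • u (S.root j)}) :
    IsFaceOf (S.orbitHull μ) F ∧ finrank ℝ (vectorSpan ℝ F) = 1 ∧ μ ∈ F ∧
      μ - S.coroot j μ • u (S.root j) ∈ F := by
  have huW := S.WI_le _ hu
  have huμ := S.fix_mu hu
  have huμ' := S.fix_mu (inv_mem hu)
  have hμF : μ ∈ F := by
    rw [hF]; exact ⟨S.self_mem_hull, 0, le_rfl, by simp⟩
  have hyF : μ - S.coroot j μ • u (S.root j) ∈ F := by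
    rw [hF]
    refine ⟨?_, _, hj.le, rfl⟩
    have e1 : u (S.s j μ) = μ - S.coroot j μ • u (S.root j) := by
      rw [s_apply, map_sub, map_smul, huμ]
    rw [← e1]; exact S.hull_stable huW (S.orbit_mem_hull (S.s_mem j))
  refine ⟨⟨?_, ?_⟩, ?_, hμF, hyF⟩
  · rw [hF]
    apply (convex_convexHull ℝ _).inter
    rintro _ ⟨t, ht, rfl⟩ _ ⟨t', ht', rfl⟩ a b ha hb hab
    refine ⟨a * t + b * t', by positivity, ?_⟩
    have : μ = (a + b) • μ := by rw [hab, one_smul]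
    nth_rw 3 [this]
    module
  · rw [hF]
    refine ⟨Set.inter_subset_left, ?_⟩
    rintro x hx y hy z ⟨hz, t, ht, hzt⟩ ⟨a, b, ha, hb, hab, habz⟩
    refine ⟨hx, ?_⟩
    obtain ⟨c, hc, ec⟩ := S.hull_le hμ (S.hull_stable (inv_mem huW) hx)
    obtain ⟨d, hd, ed⟩ := S.hull_le hμ (S.hull_stable (inv_mem huW) hy)
    have huu : ∀ v, u⁻¹ (u v) = v := by
      intro v; rw [← LinearEquiv.mul_apply, inv_mul_cancel]; rfl
    have huu' : ∀ v, u (u⁻¹ v) = v := by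
      intro v; rw [← LinearEquiv.mul_apply, mul_inv_cancel]; rfl
    have e3 : a • (μ - u⁻¹ x) + b • (μ - u⁻¹ y) = t • S.root j := by
      have h1 : u⁻¹ z = μ - t • S.root j := by rw [hzt, map_sub, map_smul, huμ', huu]
      rw [← habz, map_add, map_smul, map_smul] at h1
      have : a • (μ - u⁻¹ x) + b • (μ - u⁻¹ y) = (a + b) • μ - (a • u⁻¹ x + b • u⁻¹ y) := by
        module
      rw [this, h1, hab]; module
    have hzero : ∀ k, k ≠ j → c k = 0 := by
      intro k hk
      obtain ⟨f, hf⟩ := S.exists_coord k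
      have h2 := congrArg f e3
      rw [ec, ed] at h2
      simp [hf, hk.symm] at h2
      have h3 := mul_nonneg ha.le (hc k)
      have h4 := mul_nonneg hb.le (hd k)
      have h5 : a * c k = 0 := by linarith
      exact (mul_eq_zero.1 h5).resolve_left ha.ne'
    refine ⟨c j, hc j, ?_⟩
    have h6 : μ - u⁻¹ x = c j • S.root j := by
      rw [ec]
      refine Finset.sum_eq_single j (fun k _ hk => by rw [hzero k hk, zero_smul]) (by simp)
    have h7 := congrArg u h6
    rw [map_sub, huμ, huu', map_smul] at h7
    rw [← h7]; abel
  · have hspan : vectorSpan ℝ F = Submodule.span ℝ {u (S.root j)} := by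
      apply le_antisymm
      · rw [vectorSpan_eq_span_vsub_set_right ℝ hμF, Submodule.span_le]
        rintro _ ⟨x, hx, rfl⟩
        rw [hF] at hx
        obtain ⟨-, t, -, rfl⟩ := hx
        refine Submodule.mem_span_singleton.2 ⟨-t, ?_⟩
        simp
      · rw [Submodule.span_singleton_le_iff_mem]
        have h := vsub_mem_vectorSpan ℝ hμF hyF
        rw [vsub_eq_sub, sub_sub_cancel] at h
        have h2 := Submodule.smul_mem _ (S.coroot j μ)⁻¹ h
        rwa [smul_smul, inv_mul_cancel₀ hj.ne', one_smul] at h2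
    rw [hspan]
    apply finrank_span_singleton
    intro h
    exact S.root_ne_zero j (u.map_eq_zero_iff.1 h)

/-! ### Components -/

lemma comp_connected {K : Set (Fin m)} {i k c : Fin m} (hk : k ∈ S.comp K i)
    (hc : c ∈ S.comp K i) : ∃ (hk : k ∈ S.comp K i) (hc : c ∈ S.comp K i),
      (S.diagram.induce (S.comp K i)).Reachable ⟨k, hk⟩ ⟨c, hc⟩ := by
  have key : ∀ x y : K, (S.diagram.induce K).Reachable x y → ∀ hx : x.1 ∈ S.comp K i,
      ∃ hy : y.1 ∈ S.comp K i,
        (S.diagram.induce (S.comp K i)).Reachable ⟨x.1, hx⟩ ⟨y.1, hy⟩ := by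
    rintro x y ⟨p⟩
    induction p with
    | nil => intro hx; exact ⟨hx, SimpleGraph.Reachable.refl _⟩
    | cons hadj p ih =>
      rename_i x y z
      intro hx
      have hy : y.1 ∈ S.comp K i := by
        obtain ⟨hi, hxK, hr⟩ := hx
        exact ⟨hi, y.2, hr.trans hadj.reachable⟩
      obtain ⟨hz, hr⟩ := ih hy
      refine ⟨hz, SimpleGraph.Reachable.trans ?_ hr⟩
      apply SimpleGraph.Adj.reachable
      exact hadj
  obtain ⟨hi, hkK, hrk⟩ := id hk
  obtain ⟨hi', hcK, hrc⟩ := id hc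
  obtain ⟨hc', hr⟩ := key _ _ (hrk.symm.trans hrc) hk
  exact ⟨hk, hc', hr⟩

lemma exists_boundary {μ : V} {i : Fin m} (hi : i ∈ S.muPart μ Set.univ ∩ S.J0 μ) :
    ∃ k ∈ S.comp (S.muPart μ Set.univ ∩ S.J0 μ) i, ∃ j, S.coroot j μ ≠ 0 ∧
      S.coroot k (S.root j) ≠ 0 := by
  obtain ⟨⟨hiu, k0, hk0, hne, ⟨p⟩⟩, hi0⟩ := id hi
  have key : ∀ x y : (Set.univ : Set (Fin m)), (S.diagram.induce Set.univ).Walk x y →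
      S.coroot y.1 μ ≠ 0 → x.1 ∈ S.comp (S.muPart μ Set.univ ∩ S.J0 μ) i →
      ∃ k ∈ S.comp (S.muPart μ Set.univ ∩ S.J0 μ) i, ∃ j, S.coroot j μ ≠ 0 ∧
      S.coroot k (S.root j) ≠ 0 := by
    intro x y p
    induction p with
    | nil =>
      rintro hy ⟨_, hx, _⟩
      exact absurd hx.2 hy
    | cons hadj p ih =>
      rename_i x y z
      intro hz hx
      have hadj' : S.Adjacent x.1 y.1 := hadj
      by_cases hy : S.coroot y.1 μ = 0
      · apply ih hz
        obtain ⟨hi, hxK, hr⟩ := hx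
        have hyK : y.1 ∈ S.muPart μ Set.univ ∩ S.J0 μ :=
          ⟨S.mem_muPart_of_adj hxK.1 ⟨hadj'.1.symm, hadj'.2.2, hadj'.2.1⟩, hy⟩
        refine ⟨hi, hyK, hr.trans ?_⟩
        apply SimpleGraph.Adj.reachable
        exact hadj'
      · refine ⟨x.1, hx, y.1, hy, ?_⟩
        rw [S.pairing]
        exact_mod_cast hadj'.2.1
  exact key _ _ p hne ⟨hi, hi, SimpleGraph.Reachable.refl _⟩

end GCMRealization

open GCMRealization in
theorem statement_16 {m : ℕ} {V : Type*} [NormedAddCommGroup V] [NormedSpace ℝ V]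
    (S : GCMRealization m V) (μ : V) (hμ : μ ∈ S.chamber) :
    {F : Set V | IsFaceOf (S.orbitHull μ) F ∧ finrank ℝ (vectorSpan ℝ F) = 1 ∧
      μ ∈ F}.Finite ↔
      S.FinTypeComponents (S.muPart μ Set.univ ∩ S.J0 μ) := by
  constructor
  · intro hfin i hi
    obtain ⟨k, hk, j, hj, hkj⟩ := S.exists_boundary hi
    have hjpos : 0 < S.coroot j μ := lt_of_le_of_ne (hμ j) (Ne.symm hj)
    have hCJ : S.comp (S.muPart μ Set.univ ∩ S.J0 μ) i ⊆ S.J0 μ := by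
      rintro c ⟨_, hc, _⟩; exact hc.2
    refine S.finite_of_orbit j k hk hkj (fun c hc => S.comp_connected hk hc) ?_
    refine Set.Finite.of_injOn
      (f := fun v => S.orbitHull μ ∩ {x | ∃ t : ℝ, 0 ≤ t ∧ x = μ - t • v}) ?_ ?_ hfin
    · rintro _ ⟨u, hu, rfl⟩
      obtain ⟨h1, h2, h3, -⟩ := S.edge_isFace hμ (S.WI_mono hCJ hu) hjpos rfl
      exact ⟨h1, h2, h3⟩
    · rintro _ ⟨u, hu, rfl⟩ _ ⟨u', hu', rfl⟩ h
      obtain ⟨-, -, -, h4⟩ := S.edge_isFace hμ (S.WI_mono hCJ hu) hjpos rfl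
      have h : S.orbitHull μ ∩ {x | ∃ t : ℝ, 0 ≤ t ∧ x = μ - t • u (S.root j)} =
        S.orbitHull μ ∩ {x | ∃ t : ℝ, 0 ≤ t ∧ x = μ - t • u' (S.root j)} := h
      rw [h] at h4
      obtain ⟨-, t, ht, e⟩ := h4
      have e' : S.coroot j μ • u (S.root j) = t • u' (S.root j) := sub_right_injective e
      obtain ⟨f, hf⟩ := S.exists_coord j
      have hf0 : ∀ c ∈ S.J0 μ, f (S.root c) = 0 := by
        intro c hc
        rw [hf, if_neg]
        rintro rfl
        exact hj hc
      have e2 := congrArg f e'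
      rw [map_smul, map_smul, S.coord_inv hf0 (S.WI_mono hCJ hu),
        S.coord_inv hf0 (S.WI_mono hCJ hu'), hf] at e2
      simp at e2
      rw [← e2] at e'
      exact smul_right_injective V hj e'
  · intro h
    have hK := S.finite_of_comps h
    have horb : (⋃ i ∈ {i | S.coroot i μ ≠ 0},
        {v | ∃ u ∈ S.WI (S.J0 μ), v = u (S.root i)}).Finite := by
      refine Set.Finite.biUnion (Set.toFinite _) ?_
      intro i hi
      refine (hK.image (fun u => u (S.root i))).subset ?_
      rintro _ ⟨u, hu, rfl⟩
      obtain ⟨u', hu', e⟩ := S.orbit_reduce (S.mem_muPart_of_ne hi) hu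
      exact ⟨u', hu', e.symm⟩
    refine (horb.image (fun d => S.orbitHull μ ∩ {x | ∃ t : ℝ, x = μ + t • d})).subset ?_
    rintro E ⟨hE, hdim, hμE⟩
    obtain ⟨u, hu, i, hi, hy⟩ := S.edge_direction hμ hE hdim hμE
    refine ⟨u (S.root i), ?_, ?_⟩
    · simp only [Set.mem_iUnion]
      exact ⟨i, hi.ne', u, hu, rfl⟩
    · refine (S.edge_eq hE hdim hμE (d := u (S.root i)) ?_ hi hy).symm
      intro h0
      exact S.root_ne_zero i (u.map_eq_zero_iff.1 h0)
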